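/- There exists a 3-dimensional subspace L of the quadratic forms in k[x₀,x₁,x₂,x₃] such that K(L) = 0; equivalently, for a basis q₀,…,q₆ of L^⊥, the substitution map C(y₀,…,y₆) ↦ C(q₀,…,q₆) from the 84-dimensional space of homogeneous cubics in k[y₀,…,y₆] to the 84-dimensional space of homogeneous sextics in k[x₀,…,x₃] is a linear isomorphism. -/

import Mathlib

open MvPolynomial

noncomputable section

variable {k : Type} [Field k]

/-- The constant-coefficient differential operator `∂^m` on `k[x₀,x₁,x₂,x₃]`
associated to a monomial exponent vector `m`. -/
noncomputable def monD (k : Type) [Field k] (m : Fin 4 →₀ ℕ) :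
    Module.End k (MvPolynomial (Fin 4) k) :=
  ((pderiv (0 : Fin 4)).toLinearMap) ^ (m 0) * ((pderiv 1).toLinearMap) ^ (m 1) *
    ((pderiv 2).toLinearMap) ^ (m 2) * ((pderiv 3).toLinearMap) ^ (m 3)

/-- The apolarity action `f(∂)(g)` of a polynomial `f` (viewed as a constant
coefficient differential operator) on a polynomial `g`. -/
noncomputable def diffOp (f g : MvPolynomial (Fin 4) k) : MvPolynomial (Fin 4) k :=
  ∑ m ∈ f.support, (coeff m f) • (monD k m g)

/-- The apolar perpendicular of a space `L` of quadratic forms: all quadratic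
forms `q` with `⟨q, f⟩ = q(∂)(f) = 0` for all `f ∈ L`. -/
def perpSet (L : Submodule k (MvPolynomial (Fin 4) k)) : Set (MvPolynomial (Fin 4) k) :=
  {q | q.IsHomogeneous 2 ∧ ∀ f ∈ L, diffOp q f = 0}

/-- `q : Fin 7 → k[x]₂` is a basis of `L^⊥`. -/
def IsPerpBasis (L : Submodule k (MvPolynomial (Fin 4) k))
    (q : Fin 7 → MvPolynomial (Fin 4) k) : Prop :=
  LinearIndependent k q ∧
    (Submodule.span k (Set.range q) : Set (MvPolynomial (Fin 4) k)) = perpSet L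

/-- `K(L)`: the space of homogeneous cubics `C ∈ k[y₀,…,y₆]` with `C(q₀,…,q₆) = 0`,
for a basis `q₀,…,q₆` of `L^⊥`; i.e. cubic hypersurfaces through the projected
Veronese `X_L`. -/
noncomputable def cubicRelations (q : Fin 7 → MvPolynomial (Fin 4) k) :
    Submodule k (MvPolynomial (Fin 7) k) :=
  (homogeneousSubmodule (Fin 7) k 3) ⊓ LinearMap.ker (aeval q).toLinearMap

/-- The symmetric Gram matrix of a quadratic form (characteristic ≠ 2). -/
def gram (q : MvPolynomial (Fin 4) k) : Matrix (Fin 4) (Fin 4) k :=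
  Matrix.of fun i j =>
    if i = j then coeff (Finsupp.single i 2) q
    else coeff (Finsupp.single i 1 + Finsupp.single j 1) q / 2

/-- The directional derivative `D_v = Σᵢ vᵢ ∂/∂xᵢ`. -/
noncomputable def dirDeriv (v : Fin 4 → k) (F : MvPolynomial (Fin 4) k) :
    MvPolynomial (Fin 4) k :=
  ∑ i, v i • pderiv i F


set_option maxHeartbeats 4000000 in
theorem sextic_mem (h2 : (2 : k) ≠ 0) {A : Type} [CommRing A] [Algebra k A]
    (S V : Submodule k A) (p : ∀ {a b c : A}, a ∈ V → b ∈ V → c ∈ V → a * b * c ∈ S)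
    (x y z w : A) (h0 : x * z ∈ V) (h1 : x * w ∈ V) (h2' : y * y ∈ V)
    (h3 : y * w - x * x ∈ V) (h4 : z * z - x * y ∈ V) (h5 : z * w ∈ V)
    (h6 : w * w - y * z ∈ V) :
    ∀ a b c d : ℕ, a + b + c + d = 6 → x ^ a * y ^ b * z ^ c * w ^ d ∈ S := by
  have e : ∀ {u v : A}, u ∈ S → v = u → v ∈ S := by
    intro u v hu h
    rwa [h]
  have half : ∀ {u : A}, (2 : ℤ) • u ∈ S → u ∈ S := by
    intro u hu
    have h := S.smul_mem (2⁻¹ : k) hu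
    have h' : (2 : ℤ) • u = (2 : k) • u := by
      rw [two_zsmul, two_smul]
    rwa [h', smul_smul, inv_mul_cancel₀ h2, one_smul] at h
  have m3030 : x^3*y^0*z^3*w^0 ∈ S := e (p h0 h0 h0) (by ring)
  have m3021 : x^3*y^0*z^2*w^1 ∈ S := e (p h0 h0 h1) (by ring)
  have m2220 : x^2*y^2*z^2*w^0 ∈ S := e (p h0 h0 h2') (by ring)
  have m2031 : x^2*y^0*z^3*w^1 ∈ S := e (p h0 h0 h5) (by ring)
  have m3012 : x^3*y^0*z^1*w^2 ∈ S := e (p h0 h1 h1) (by ring)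
  have m2211 : x^2*y^2*z^1*w^1 ∈ S := e (p h0 h1 h2') (by ring)
  have m3111 : x^3*y^1*z^1*w^1 ∈ S := e (S.add_mem (S.neg_mem (p h0 h1 h4)) m2031) (by ring)
  have m2022 : x^2*y^0*z^2*w^2 ∈ S := e (p h0 h1 h5) (by ring)
  have m1410 : x^1*y^4*z^1*w^0 ∈ S := e (p h0 h2' h2') (by ring)
  have m1221 : x^1*y^2*z^2*w^1 ∈ S := e (p h0 h2' h5) (by ring)
  have m1122 : x^1*y^1*z^2*w^2 ∈ S := e (S.add_mem (p h0 h3 h5) m3021) (by ring)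
  have m1032 : x^1*y^0*z^3*w^2 ∈ S := e (p h0 h5 h5) (by ring)
  have m3003 : x^3*y^0*z^0*w^3 ∈ S := e (p h1 h1 h1) (by ring)
  have m2202 : x^2*y^2*z^0*w^2 ∈ S := e (p h1 h1 h2') (by ring)
  have m3102 : x^3*y^1*z^0*w^2 ∈ S := e (S.add_mem (S.neg_mem (p h1 h1 h4)) m2022) (by ring)
  have m2013 : x^2*y^0*z^1*w^3 ∈ S := e (p h1 h1 h5) (by ring)
  have m1401 : x^1*y^4*z^0*w^1 ∈ S := e (p h1 h2' h2') (by ring)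
  have m2301 : x^2*y^3*z^0*w^1 ∈ S := e (S.add_mem (S.neg_mem (p h1 h2' h4)) m1221) (by ring)
  have m1212 : x^1*y^2*z^1*w^2 ∈ S := e (p h1 h2' h5) (by ring)
  have m4101 : x^4*y^1*z^0*w^1 ∈ S := e (S.add_mem (S.add_mem (S.sub_mem (p h1 h3 h4) m1122) m2202) m3021) (by ring)
  have m1113 : x^1*y^1*z^1*w^3 ∈ S := e (S.add_mem (p h1 h3 h5) m3012) (by ring)
  have m1104 : x^1*y^1*z^0*w^4 ∈ S := e (S.sub_mem (S.add_mem (S.add_mem (p h1 h3 h6) m1212) m3003) m3111) (by ring)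
  have m2112 : x^2*y^1*z^1*w^2 ∈ S := e (S.add_mem (S.neg_mem (p h1 h4 h5)) m1032) (by ring)
  have m1023 : x^1*y^0*z^2*w^3 ∈ S := e (p h1 h5 h5) (by ring)
  have m1014 : x^1*y^0*z^1*w^4 ∈ S := e (S.add_mem (p h1 h5 h6) m1122) (by ring)
  have m1005 : x^1*y^0*z^0*w^5 ∈ S := e (S.sub_mem (S.add_mem (p h1 h6 h6) (zsmul_mem m1113 (2))) m1221) (by ring)
  have m0600 : x^0*y^6*z^0*w^0 ∈ S := e (p h2' h2' h2') (by ring)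
  have m0411 : x^0*y^4*z^1*w^1 ∈ S := e (p h2' h2' h5) (by ring)
  have m0312 : x^0*y^3*z^1*w^2 ∈ S := e (S.add_mem (p h2' h3 h5) m2211) (by ring)
  have m0222 : x^0*y^2*z^2*w^2 ∈ S := e (p h2' h5 h5) (by ring)
  have m0132 : x^0*y^1*z^3*w^2 ∈ S := e (S.sub_mem (S.add_mem (S.add_mem (p h3 h4 h5) m1212) m2031) m3111) (by ring)
  have m0123 : x^0*y^1*z^2*w^3 ∈ S := e (S.add_mem (p h3 h5 h5) m2022) (by ring)
  have m0042 : x^0*y^0*z^4*w^2 ∈ S := e (S.add_mem (p h4 h5 h5) m1122) (by ring)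
  have m0033 : x^0*y^0*z^3*w^3 ∈ S := e (p h5 h5 h5) (by ring)
  have m0024 : x^0*y^0*z^2*w^4 ∈ S := e (S.add_mem (p h5 h5 h6) m0132) (by ring)
  have m2130 : x^2*y^1*z^3*w^0 ∈ S := e (S.add_mem (S.neg_mem (p h0 h0 h6)) m2022) (by ring)
  have m4011 : x^4*y^0*z^1*w^1 ∈ S := e (S.add_mem (S.neg_mem (p h0 h1 h3)) m2112) (by ring)
  have m2121 : x^2*y^1*z^2*w^1 ∈ S := e (S.add_mem (S.neg_mem (p h0 h1 h6)) m2013) (by ring)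
  have m1320 : x^1*y^3*z^2*w^0 ∈ S := e (S.add_mem (S.neg_mem (p h0 h2' h6)) m1212) (by ring)
  have m5010 : x^5*y^0*z^1*w^0 ∈ S := e (S.add_mem (S.sub_mem (p h0 h3 h3) m1212) (zsmul_mem m3111 (2))) (by ring)
  have m3120 : x^3*y^1*z^2*w^0 ∈ S := e (S.add_mem (S.add_mem (S.sub_mem (p h0 h3 h6) m1113) m1221) m3012) (by ring)
  have m1041 : x^1*y^0*z^4*w^1 ∈ S := e (S.add_mem (p h0 h4 h5) m2121) (by ring)
  have m1140 : x^1*y^1*z^4*w^0 ∈ S := e (S.add_mem (S.sub_mem (S.add_mem (S.neg_mem (p h0 h4 h6)) m1032) m2112) m2220) (by ring)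
  have m1131 : x^1*y^1*z^3*w^1 ∈ S := e (S.add_mem (S.neg_mem (p h0 h5 h6)) m1023) (by ring)
  have m1230 : x^1*y^2*z^3*w^0 ∈ S := e (S.add_mem (S.sub_mem (p h0 h6 h6) m1014) (zsmul_mem m1122 (2))) (by ring)
  have m2004 : x^2*y^0*z^0*w^4 ∈ S := e (S.add_mem (p h1 h1 h6) m2112) (by ring)
  have m3201 : x^3*y^2*z^0*w^1 ∈ S := e (S.add_mem (S.sub_mem (p h1 h4 h4) m1041) (zsmul_mem m2121 (2))) (by ring)
  have m2103 : x^2*y^1*z^0*w^3 ∈ S := e (S.add_mem (S.sub_mem (S.add_mem (S.neg_mem (p h1 h4 h6)) m1023) m1131) m2211) (by ring)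
  have m0213 : x^0*y^2*z^1*w^3 ∈ S := e (S.sub_mem (S.add_mem (p h3 h3 h5) (zsmul_mem m2112 (2))) m4011) (by ring)
  have m0114 : x^0*y^1*z^1*w^4 ∈ S := e (S.sub_mem (S.add_mem (S.add_mem (p h3 h5 h6) m0222) m2013) m2121) (by ring)
  have m0051 : x^0*y^0*z^5*w^1 ∈ S := e (S.sub_mem (S.add_mem (p h4 h4 h5) (zsmul_mem m1131 (2))) m2211) (by ring)
  have m0141 : x^0*y^1*z^4*w^1 ∈ S := e (S.add_mem (S.sub_mem (S.add_mem (S.neg_mem (p h4 h5 h6)) m0033) m1113) m1221) (by ring)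
  have m0240 : x^0*y^2*z^4*w^0 ∈ S := e (S.add_mem (S.add_mem (S.add_mem (S.add_mem (S.sub_mem (p h4 h6 h6) m0024) (zsmul_mem m0132 (2))) m1104) (zsmul_mem m1212 (-2))) m1320) (by ring)
  have m4020 : x^4*y^0*z^2*w^0 ∈ S := e (S.add_mem (S.neg_mem (p h0 h0 h3)) m2121) (by ring)
  have m2040 : x^2*y^0*z^4*w^0 ∈ S := e (S.add_mem (p h0 h0 h4) m3120) (by ring)
  have m2310 : x^2*y^3*z^1*w^0 ∈ S := e (S.add_mem (S.neg_mem (p h0 h2' h4)) m1230) (by ring)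
  have m4110 : x^4*y^1*z^1*w^0 ∈ S := e (S.add_mem (S.add_mem (S.sub_mem (p h0 h3 h4) m1131) m2211) m3030) (by ring)
  have m4002 : x^4*y^0*z^0*w^2 ∈ S := e (S.add_mem (S.neg_mem (p h1 h1 h3)) m2103) (by ring)
  have m1302 : x^1*y^3*z^0*w^2 ∈ S := e (S.add_mem (p h1 h2' h3) m3201) (by ring)
  have m0303 : x^0*y^3*z^0*w^3 ∈ S := e (S.sub_mem (S.add_mem (S.add_mem (p h2' h3 h6) m0411) m2202) m2310) (by ring)
  have m2400 : x^2*y^4*z^0*w^0 ∈ S := e (S.add_mem (S.sub_mem (p h2' h4 h4) m0240) (zsmul_mem m1320 (2))) (by ring)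
  have m0330 : x^0*y^3*z^3*w^0 ∈ S := e (S.add_mem (S.sub_mem (S.add_mem (S.neg_mem (p h2' h4 h6)) m0222) m1302) m1410) (by ring)
  have m0321 : x^0*y^3*z^2*w^1 ∈ S := e (S.add_mem (S.neg_mem (p h2' h5 h6)) m0213) (by ring)
  have m6000 : x^6*y^0*z^0*w^0 ∈ S := e (S.add_mem (S.add_mem (S.add_mem (S.neg_mem (p h3 h3 h3)) m0303) (zsmul_mem m2202 (-3))) (zsmul_mem m4101 (3))) (by ring)
  have m5100 : x^5*y^1*z^0*w^0 ∈ S := e (S.add_mem (S.add_mem (S.add_mem (S.sub_mem (S.add_mem (S.neg_mem (p h3 h3 h4)) m0222) m1302) (zsmul_mem m2121 (-2))) (zsmul_mem m3201 (2))) m4020) (by ring)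
  have m0204 : x^0*y^2*z^0*w^4 ∈ S := e (S.add_mem (S.sub_mem (S.add_mem (S.add_mem (S.add_mem (p h3 h3 h6) m0312) (zsmul_mem m2103 (2))) (zsmul_mem m2211 (-2))) m4002) m4110) (by ring)
  have m4200 : x^4*y^2*z^0*w^0 ∈ S := e (S.add_mem (S.sub_mem (S.add_mem (S.add_mem (S.add_mem (S.neg_mem (p h3 h4 h4)) m0141) (zsmul_mem m1221 (-2))) m2301) m2040) (zsmul_mem m3120 (2))) (by ring)
  have m0105 : x^0*y^1*z^0*w^5 ∈ S := e (S.add_mem (S.add_mem (S.add_mem (S.sub_mem (S.add_mem (p h3 h6 h6) (zsmul_mem m0213 (2))) m0321) m2004) (zsmul_mem m2112 (-2))) m2220) (by ring)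
  have m0150 : x^0*y^1*z^5*w^0 ∈ S := e (S.sub_mem (S.add_mem (S.add_mem (S.add_mem (S.add_mem (S.neg_mem (p h4 h4 h6)) m0042) (zsmul_mem m1122 (-2))) (zsmul_mem m1230 (2))) m2202) m2310) (by ring)
  have m0006 : x^0*y^0*z^0*w^6 ∈ S := e (S.add_mem (S.add_mem (S.add_mem (p h6 h6 h6) (zsmul_mem m0114 (3))) (zsmul_mem m0222 (-3))) m0330) (by ring)
  have m0501 : x^0*y^5*z^0*w^1 ∈ S := e (S.add_mem (p h2' h2' h3) m2400) (by ring)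
  have m0402 : x^0*y^4*z^0*w^2 ∈ S := e (S.sub_mem (S.add_mem (p h2' h3 h3) (zsmul_mem m2301 (2))) m4200) (by ring)
  have m3300 : x^3*y^3*z^0*w^0 ∈ S := e (S.add_mem (S.add_mem (S.sub_mem (p h2' h3 h4) m0321) m1401) m2220) (by ring)
  have m0420 : x^0*y^4*z^2*w^0 ∈ S := e (S.add_mem (S.sub_mem (p h2' h6 h6) m0204) (zsmul_mem m0312 (2))) (by ring)
  have m0060 : x^0*y^0*z^6*w^0 ∈ S := e (S.add_mem (S.add_mem (S.add_mem (p h4 h4 h4) (zsmul_mem m1140 (3))) (zsmul_mem m2220 (-3))) m3300) (by ring)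
  have m1500 : x^1*y^5*z^0*w^0 ∈ S := e (S.add_mem (S.neg_mem (p h2' h2' h4)) m0420) (by ring)
  have m0510 : x^0*y^5*z^1*w^0 ∈ S := e (S.add_mem (S.neg_mem (p h2' h2' h6)) m0402) (by ring)
  have t : (2:ℤ) • (x^3*y^2*z^1*w^0) ∈ S := e (S.add_mem (S.sub_mem (S.sub_mem (S.sub_mem (S.sub_mem (S.sub_mem (S.sub_mem (p h3 h5 h5) (p h3 h4 h6)) (p h1 h2' h6)) (p h1 h1 h4)) (p h0 h0 h6)) (p h2' h4 h5)) (p h0 h2' h3)) (zsmul_mem (p h0 h1 h5) (2))) (by ring)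
  have m3210 : x^3*y^2*z^1*w^0 ∈ S := half t
  have m1311 : x^1*y^3*z^1*w^1 ∈ S := e (S.add_mem (p h0 h2' h3) m3210) (by ring)
  have m1050 : x^1*y^0*z^5*w^0 ∈ S := e (S.sub_mem (S.add_mem (p h0 h4 h4) (zsmul_mem m2130 (2))) m3210) (by ring)
  have m1203 : x^1*y^2*z^0*w^3 ∈ S := e (S.add_mem (p h1 h2' h6) m1311) (by ring)
  have m5001 : x^5*y^0*z^0*w^1 ∈ S := e (S.add_mem (S.sub_mem (p h1 h3 h3) m1203) (zsmul_mem m3102 (2))) (by ring)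
  have m0231 : x^0*y^2*z^3*w^1 ∈ S := e (S.add_mem (p h2' h4 h5) m1311) (by ring)
  have m0015 : x^0*y^0*z^1*w^5 ∈ S := e (S.sub_mem (S.add_mem (p h5 h6 h6) (zsmul_mem m0123 (2))) m0231) (by ring)
  intro a b c d h
  have ha : a ≤ 6 := by omega
  have hb : b ≤ 6 := by omega
  have hc : c ≤ 6 := by omega
  obtain rfl : d = 6 - a - b - c := by omega
  have hd : a + b + c ≤ 6 := by omega
  clear h p e half
  interval_cases a <;> interval_cases b <;> first
    | (exfalso; omega)
    | (interval_cases c <;> first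
        | (exfalso; omega)
        | (simp only [Nat.reduceSub]; with_reducible assumption))

theorem diffOp_eq (f g : MvPolynomial (Fin 4) k) (s : Finset (Fin 4 →₀ ℕ)) (h : f.support ⊆ s) :
    diffOp f g = ∑ m ∈ s, (coeff m f) • (monD k m g) := by
  unfold diffOp
  apply Finset.sum_subset h
  intro m _ hm
  rw [notMem_support_iff.mp hm, zero_smul]

theorem diffOp_sub (f f' g : MvPolynomial (Fin 4) k) :
    diffOp (f - f') g = diffOp f g - diffOp f' g := by
  classical
  rw [diffOp_eq (f - f') g (f.support ∪ f'.support) (support_sub _ f f'),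
    diffOp_eq f g (f.support ∪ f'.support) Finset.subset_union_left,
    diffOp_eq f' g (f.support ∪ f'.support) Finset.subset_union_right, ← Finset.sum_sub_distrib]
  simp [sub_smul]

theorem diffOp_XX (i j : Fin 4) (g : MvPolynomial (Fin 4) k) :
    diffOp (X i * X j) g = pderiv i (pderiv j g) := by
  classical
  have h : (X i * X j : MvPolynomial (Fin 4) k)
      = monomial (Finsupp.single i 1 + Finsupp.single j 1) 1 := by
    simp [X, monomial_mul]
  have c : ∀ a b : Fin 4, pderiv a (pderiv b g) = pderiv b (pderiv a g) := by
    intro a b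
    induction g using MvPolynomial.induction_on with
    | C r => simp
    | add p q hp hq => simp [hp, hq]
    | mul_X p i hp =>
      simp only [Derivation.leibniz, map_add, pderiv_X, smul_eq_mul, hp]
      rcases eq_or_ne i a with rfl | ha <;> rcases eq_or_ne i b with rfl | hb <;>
        simp_all <;> ring
  rw [h, diffOp_eq _ g _ support_monomial_subset]
  fin_cases i <;> fin_cases j <;>
    simp [monD, pow_two, c 1 0, c 2 0, c 3 0, c 2 1, c 3 1, c 3 2]

theorem diffOp_lin (f : MvPolynomial (Fin 4) k) (s : Set (MvPolynomial (Fin 4) k))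
    (h : ∀ g ∈ s, diffOp f g = 0) : ∀ g ∈ Submodule.span k s, diffOp f g = 0 := by
  let T : MvPolynomial (Fin 4) k →ₗ[k] MvPolynomial (Fin 4) k :=
    ∑ m ∈ f.support, (coeff m f) • (monD k m)
  have hT : ∀ g, T g = diffOp f g := by
    intro g
    simp [T, diffOp]
  intro g hg
  rw [← hT]
  have : Submodule.span k s ≤ LinearMap.ker T := by
    rw [Submodule.span_le]
    intro u hu
    simp [hT, h u hu]
  exact this hg

theorem finrank_hom (n d : ℕ) :
    Module.finrank k (homogeneousSubmodule (Fin n) k d) = (n + d - 1).choose d := by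
  classical
  have e : homogeneousSubmodule (Fin n) k d = restrictSupport k {m : Fin n →₀ ℕ | m.degree = d} :=
    homogeneousSubmodule_eq_finsupp_supported _ _ _
  have hs : {m : Fin n →₀ ℕ | m.degree = d}
      = ((Finset.univ.finsuppAntidiag d : Finset (Fin n →₀ ℕ)) : Set (Fin n →₀ ℕ)) := by
    ext m
    simp [Finsupp.degree_eq_sum]
  rw [e, hs, Module.finrank_eq_card_basis (basisRestrictSupport k _)]
  simp [Finset.card_finsuppAntidiag_nat_eq_choose]

/-- The three generators of the center. -/
def cen (k : Type) [Field k] : Fin 3 → MvPolynomial (Fin 4) k :=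
  ![X 0 * X 0 + C 2 * (X 1 * X 3), X 2 * X 2 + C 2 * (X 0 * X 1), X 3 * X 3 + C 2 * (X 1 * X 2)]

theorem XX_hom (i j : Fin 4) : (X i * X j : MvPolynomial (Fin 4) k).IsHomogeneous 2 :=
  (isHomogeneous_X k i).mul (isHomogeneous_X k j)

theorem cen_hom (i : Fin 3) : (cen k i).IsHomogeneous 2 := by
  have h : ∀ a b : Fin 4, (C 2 * (X a * X b) : MvPolynomial (Fin 4) k).IsHomogeneous 2 := by
    intro a b
    simpa using (isHomogeneous_C (Fin 4) (2 : k)).mul (XX_hom (k := k) a b)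
  fin_cases i
  · exact (XX_hom 0 0).add (h 1 3)
  · exact (XX_hom 2 2).add (h 0 1)
  · exact (XX_hom 3 3).add (h 1 2)

theorem cen_indep : LinearIndependent k (cen k) := by
  rw [Fintype.linearIndependent_iff]
  intro g hg
  simp only [Fin.sum_univ_three] at hg
  have h0 := congrArg (eval (![1, 0, 0, 0] : Fin 4 → k)) hg
  have h1 := congrArg (eval (![0, 0, 1, 0] : Fin 4 → k)) hg
  have h2 := congrArg (eval (![0, 0, 0, 1] : Fin 4 → k)) hg
  simp [cen] at h0 h1 h2
  intro i
  fin_cases i <;> assumption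

theorem perp_mem (q : MvPolynomial (Fin 4) k) (hq : q.IsHomogeneous 2)
    (h : ∀ i, diffOp q (cen k i) = 0) :
    q ∈ perpSet (Submodule.span k (Set.range (cen k))) := by
  refine ⟨hq, diffOp_lin q _ ?_⟩
  rintro _ ⟨i, rfl⟩
  exact h i

theorem prod3_mem (q : Fin 7 → MvPolynomial (Fin 4) k) {a b c : MvPolynomial (Fin 4) k}
    (ha : a ∈ Submodule.span k (Set.range q)) (hb : b ∈ Submodule.span k (Set.range q))
    (hc : c ∈ Submodule.span k (Set.range q)) :
    a * b * c ∈ (homogeneousSubmodule (Fin 7) k 3).map (aeval q).toLinearMap := by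
  have key : Submodule.span k (Set.range q)
      ≤ (homogeneousSubmodule (Fin 7) k 1).map (aeval q).toLinearMap := by
    rw [Submodule.span_le]
    rintro _ ⟨i, rfl⟩
    exact ⟨X i, isHomogeneous_X k i, by simp⟩
  obtain ⟨a', ha', rfl⟩ := key ha
  obtain ⟨b', hb', rfl⟩ := key hb
  obtain ⟨c', hc', rfl⟩ := key hc
  exact ⟨a' * b' * c', (IsHomogeneous.mul (IsHomogeneous.mul ha' hb') hc'), by simp⟩

/-- There exists a 3-dimensional space `L` of quadratic forms
in `k[x₀,x₁,x₂,x₃]` with `K(L) = 0`: for a basis `q₀,…,q₆` of `L^⊥` no nonzero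
homogeneous cubic `C ∈ k[y₀,…,y₆]` satisfies `C(q₀,…,q₆) = 0`; equivalently the
substitution map from the 84-dimensional space of cubics in `k[y₀,…,y₆]` to the
84-dimensional space of sextics in `k[x₀,…,x₃]` is a linear isomorphism. -/
theorem exists_center_with_no_cubics
    [IsAlgClosed k] (h2 : (2 : k) ≠ 0) (h3 : (3 : k) ≠ 0) :
    ∃ L : Submodule k (MvPolynomial (Fin 4) k),
      L ≤ homogeneousSubmodule (Fin 4) k 2 ∧
      Module.finrank k L = 3 ∧
      ∀ q : Fin 7 → MvPolynomial (Fin 4) k, IsPerpBasis L q →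
        cubicRelations q = ⊥ := by
  refine ⟨Submodule.span k (Set.range (cen k)), ?_, ?_, ?_⟩
  · rw [Submodule.span_le]
    rintro _ ⟨i, rfl⟩
    exact cen_hom i
  · rw [finrank_span_eq_card cen_indep]
    simp
  intro q hq
  set S := (homogeneousSubmodule (Fin 7) k 3).map (aeval q).toLinearMap with hS
  have hV : ∀ r : MvPolynomial (Fin 4) k, r.IsHomogeneous 2 → (∀ i, diffOp r (cen k i) = 0) →
      r ∈ Submodule.span k (Set.range q) := by
    intro r h1 h2
    have := perp_mem r h1 h2
    rw [← hq.2] at this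
    exact this
  have hC : (C 2 : MvPolynomial (Fin 4) k) = 2 := map_ofNat C 2
  have hle : homogeneousSubmodule (Fin 4) k 6 ≤ S := by
    have hm := sextic_mem h2 S (Submodule.span k (Set.range q))
      (fun ha hb hc => prod3_mem q ha hb hc) (X 0) (X 1) (X 2) (X 3)
      (hV _ (XX_hom _ _) (by
        intro i; fin_cases i <;> simp [cen, diffOp_XX, pderiv_X]))
      (hV _ (XX_hom _ _) (by
        intro i; fin_cases i <;> simp [cen, diffOp_XX, pderiv_X]))
      (hV _ (XX_hom _ _) (by
        intro i; fin_cases i <;> simp [cen, diffOp_XX, pderiv_X]))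
      (hV _ ((XX_hom _ _).sub (XX_hom _ _)) (by
        intro i; fin_cases i <;>
          simp [cen, diffOp_sub, diffOp_XX, pderiv_X, one_add_one_eq_two] <;> simp [hC]))
      (hV _ ((XX_hom _ _).sub (XX_hom _ _)) (by
        intro i; fin_cases i <;>
          simp [cen, diffOp_sub, diffOp_XX, pderiv_X, one_add_one_eq_two] <;> simp [hC]))
      (hV _ (XX_hom _ _) (by
        intro i; fin_cases i <;> simp [cen, diffOp_XX, pderiv_X]))
      (hV _ ((XX_hom _ _).sub (XX_hom _ _)) (by
        intro i; fin_cases i <;>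
          simp [cen, diffOp_sub, diffOp_XX, pderiv_X, one_add_one_eq_two] <;> simp [hC]))
    intro f hf
    rw [f.as_sum]
    refine Submodule.sum_mem _ fun m hmf => ?_
    have hd : m.degree = 6 := by
      by_contra hne
      exact (mem_support_iff.mp hmf) (IsHomogeneous.coeff_eq_zero hf hne)
    rw [monomial_eq, ← smul_eq_C_mul]
    refine S.smul_mem _ ?_
    have := hm (m 0) (m 1) (m 2) (m 3) (by
      rw [← hd, Finsupp.degree_eq_sum, Fin.sum_univ_four])
    rw [Finsupp.prod_fintype _ _ (by simp), Fin.prod_univ_four]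
    exact this
  have hfd : Module.Finite k (homogeneousSubmodule (Fin 7) k 3) :=
    Module.Finite.iff_fg.mpr (homogeneousSubmodule_fg (Fin 7) k 3)
  let T := (aeval q : MvPolynomial (Fin 7) k →ₐ[k] MvPolynomial (Fin 4) k).toLinearMap.domRestrict
    (homogeneousSubmodule (Fin 7) k 3)
  have hr : LinearMap.range T = S := by
    rw [hS, LinearMap.range_domRestrict]
  have hfS : Module.Finite k S := by
    rw [← hr]
    infer_instance
  have h84 : 84 ≤ Module.finrank k S := by
    have := Submodule.finrank_mono hle
    rw [finrank_hom] at this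
    exact this
  have hrn := LinearMap.finrank_range_add_finrank_ker T
  rw [hr, finrank_hom] at hrn
  have h84' : (7 + 3 - 1).choose 3 = 84 := by decide
  rw [h84'] at hrn
  have hk : LinearMap.ker T = ⊥ := Submodule.finrank_eq_zero.mp (by omega)
  rw [eq_bot_iff]
  rintro c ⟨hc1, hc2⟩
  have : (⟨c, hc1⟩ : homogeneousSubmodule (Fin 7) k 3) ∈ LinearMap.ker T := hc2
  rw [hk, Submodule.mem_bot] at this
  exact congrArg Subtype.val this
end
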